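/- arXiv:2102.09911 — 2 statements merged into one kernel-verified Lean document; each statement's English description precedes it below -/
import Mathlib

section
/- For every real symmetric 2×2 matrix τ with eigenvalues τ₁, τ₂, one has j̄*(τ) = ½(|τ₁| + |τ₂|)², where j̄*(τ) := sup{ ξ:τ − j̄(ξ) : ξ real symmetric 2×2 } and j̄(ξ) := sup{ ξ:σ − ½|σ|² : σ real symmetric 2×2 with det σ = 0 }. -/
open Matrix Polynomial
open scoped BigOperators

/-- Squared Frobenius norm of a matrix. -/
noncomputable def frobSq {n : ℕ} (ξ : Matrix (Fin n) (Fin n) ℝ) : ℝ :=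
  ∑ i, ∑ j, (ξ i j) ^ 2

/-- Frobenius inner product ξ:τ = tr(ξτ) of symmetric matrices. -/
noncomputable def frobInner {n : ℕ} (ξ τ : Matrix (Fin n) (Fin n) ℝ) : ℝ :=
  Matrix.trace (ξ * τ)

/-- j̄(ξ) = sup over singular symmetric σ of (ξ:σ − ½|σ|²). -/
noncomputable def jbar {n : ℕ} (ξ : Matrix (Fin n) (Fin n) ℝ) : ℝ :=
  sSup {v : ℝ | ∃ σ : Matrix (Fin n) (Fin n) ℝ,
    σ.IsSymm ∧ σ.det = 0 ∧ v = frobInner ξ σ - frobSq σ / 2}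

/-- The convex conjugate j̄*(τ) = sup over symmetric ξ of (ξ:τ − j̄(ξ)). -/
noncomputable def jbarStar {n : ℕ} (τ : Matrix (Fin n) (Fin n) ℝ) : ℝ :=
  sSup {v : ℝ | ∃ ξ : Matrix (Fin n) (Fin n) ℝ,
    ξ.IsSymm ∧ v = frobInner ξ τ - jbar ξ}

theorem frobInner_fin_two_of (a b c p q r : ℝ) :
    frobInner !![a, b; b, c] !![p, q; q, r] = a * p + 2 * b * q + c * r := by
  simp [frobInner, Matrix.trace_fin_two]; ring

theorem frobSq_fin_two_of (p q r : ℝ) :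
    frobSq !![p, q; q, r] = p ^ 2 + 2 * q ^ 2 + r ^ 2 := by
  simp [frobSq, Fin.sum_univ_two]; ring

theorem isSymm_fin_two_of (p q r : ℝ) : (!![p, q; q, r]).IsSymm := by
  ext i j; fin_cases i <;> fin_cases j <;> rfl

theorem Matrix.IsSymm.exists_eq_fin_two {σ : Matrix (Fin 2) (Fin 2) ℝ} (h : σ.IsSymm) :
    ∃ p q r : ℝ, σ = !![p, q; q, r] := by
  refine ⟨σ 0 0, σ 0 1, σ 1 1, ?_⟩
  rw [Matrix.eta_fin_two σ, h.apply 0 1]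
  simp

/-- Testing `jbar` with a singular matrix gives a lower bound. -/
theorem le_jbar_fin_two (x y z p q r : ℝ) (h : p * r = q ^ 2) :
    x * p + 2 * y * q + z * r - (p ^ 2 + 2 * q ^ 2 + r ^ 2) / 2 ≤ jbar !![x, y; y, z] := by
  apply le_csSup
  · refine ⟨(x ^ 2 + 2 * y ^ 2 + z ^ 2) / 2, ?_⟩
    rintro v ⟨σ, hσ, -, rfl⟩
    obtain ⟨p, q, r, rfl⟩ := hσ.exists_eq_fin_two
    rw [frobInner_fin_two_of, frobSq_fin_two_of]
    nlinarith [sq_nonneg (x - p), sq_nonneg (y - q), sq_nonneg (z - r)]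
  · refine ⟨!![p, q; q, r], isSymm_fin_two_of p q r, ?_, ?_⟩
    · rw [Matrix.det_fin_two_of]; linarith
    · rw [frobInner_fin_two_of, frobSq_fin_two_of]

/-- An upper bound valid for all singular test matrices bounds `jbar`. -/
theorem jbar_le_fin_two (x y z M : ℝ)
    (h : ∀ p q r : ℝ, p * r = q ^ 2 →
      x * p + 2 * y * q + z * r - (p ^ 2 + 2 * q ^ 2 + r ^ 2) / 2 ≤ M) :
    jbar !![x, y; y, z] ≤ M := by
  apply csSup_le
  · exact ⟨_, 0, Matrix.isSymm_zero, by simp, rfl⟩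
  · rintro v ⟨σ, hσ, hdet, rfl⟩
    obtain ⟨p, q, r, rfl⟩ := hσ.exists_eq_fin_two
    rw [Matrix.det_fin_two_of] at hdet
    rw [frobInner_fin_two_of, frobSq_fin_two_of]
    exact h p q r (by linarith)

/-- Spectral decomposition of a symmetric `2 × 2` matrix: `(p, q; q, r)` is a rank-one orthogonal
projection onto an eigenspace of `(a, b; b, c)`. -/
theorem exists_spectral_projection_fin_two (a b c s t : ℝ) (hadd : a + c = s + t)
    (hmul : a * c - b ^ 2 = s * t) :
    ∃ p q r : ℝ, p + r = 1 ∧ p * r = q ^ 2 ∧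
      a = s * p + t * r ∧ b = (s - t) * q ∧ c = s * r + t * p := by
  by_cases hst : s = t
  · subst hst
    have hsum : (a - c) ^ 2 + 4 * b ^ 2 = 0 := by
      linear_combination (a + c + 2 * s) * hadd - 4 * hmul
    have hb : b = 0 := by
      rw [← sq_eq_zero_iff]; linarith [sq_nonneg (a - c), sq_nonneg b]
    have hac : a - c = 0 := by
      rw [← sq_eq_zero_iff]; linarith [sq_nonneg (a - c), sq_nonneg b]
    exact ⟨1, 0, 0, by norm_num, by norm_num, by linarith, by simp [hb], by linarith⟩
  · have h : s - t ≠ 0 := sub_ne_zero.mpr hst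
    refine ⟨(a - t) / (s - t), b / (s - t), (c - t) / (s - t), ?_, ?_, ?_, ?_, ?_⟩
    · field_simp; linarith
    · field_simp
      linear_combination hmul - t * hadd
    · field_simp
      linear_combination -t * hadd
    · field_simp
    · field_simp
      linear_combination -t * hadd

theorem exists_sign_mul_eq_abs (s : ℝ) : ∃ u : ℝ, u ^ 2 = 1 ∧ s = u * |s| := by
  rcases abs_cases s with ⟨h, -⟩ | ⟨h, -⟩
  · exact ⟨1, by norm_num, by rw [h]; ring⟩
  · exact ⟨-1, by norm_num, by rw [h]; ring⟩

/-- The Fenchel–Young type inequality for half the squared nuclear norm. -/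
theorem frobInner_sub_jbar_le (a b c s t x y z : ℝ) (hadd : a + c = s + t)
    (hmul : a * c - b ^ 2 = s * t) :
    x * a + 2 * y * b + z * c - jbar !![x, y; y, z] ≤ (|s| + |t|) ^ 2 / 2 := by
  obtain ⟨p, q, r, hpr, hdet, ha, hb, hc⟩ :=
    exists_spectral_projection_fin_two a b c s t hadd hmul
  obtain ⟨u, hu, hs⟩ := exists_sign_mul_eq_abs s
  obtain ⟨w, hw, ht⟩ := exists_sign_mul_eq_abs t
  have hs0 := abs_nonneg s
  have ht0 := abs_nonneg t
  generalize |s| = m at *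
  generalize |t| = k at *
  have hnorm : p ^ 2 + 2 * q ^ 2 + r ^ 2 = 1 := by
    linear_combination (p + r + 1) * hpr - 2 * hdet
  have h₁ := le_jbar_fin_two x y z ((m + k) * u * p) ((m + k) * u * q) ((m + k) * u * r)
    (by linear_combination ((m + k) * u) ^ 2 * hdet)
  have h₂ := le_jbar_fin_two x y z ((m + k) * w * r) (-((m + k) * w * q)) ((m + k) * w * p)
    (by linear_combination ((m + k) * w) ^ 2 * hdet)
  have e₁ : ((m + k) * u * p) ^ 2 + 2 * ((m + k) * u * q) ^ 2 + ((m + k) * u * r) ^ 2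
      = (m + k) ^ 2 := by
    linear_combination (m + k) ^ 2 * u ^ 2 * hnorm + (m + k) ^ 2 * hu
  have e₂ : ((m + k) * w * r) ^ 2 + 2 * (-((m + k) * w * q)) ^ 2 + ((m + k) * w * p) ^ 2
      = (m + k) ^ 2 := by
    linear_combination (m + k) ^ 2 * w ^ 2 * hnorm + (m + k) ^ 2 * hw
  rw [e₁] at h₁
  rw [e₂] at h₂
  generalize jbar !![x, y; y, z] = J at *
  have key : (m + k) * (x * a + 2 * y * b + z * c - J) ≤ (m + k) * ((m + k) ^ 2 / 2) := by
    have i₁ := mul_le_mul_of_nonneg_left h₁ hs0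
    have i₂ := mul_le_mul_of_nonneg_left h₂ ht0
    have e : x * a + 2 * y * b + z * c =
        u * m * (x * p + 2 * y * q + z * r) + w * k * (x * r - 2 * y * q + z * p) := by
      rw [← hs, ← ht, ha, hb, hc]; ring
    rw [e]
    linarith
  rcases (add_nonneg hs0 ht0).eq_or_lt with h0 | hpos
  · have hm : m = 0 := by linarith
    have hk : k = 0 := by linarith
    subst hm hk
    have hs' : s = 0 := by simpa using hs
    have ht' : t = 0 := by simpa using ht
    subst hs' ht'
    simp at ha hb hc h₁
    subst ha hb hc
    simpa using h₁
  · exact le_of_mul_le_mul_left key hpos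

/-- The bound of `frobInner_sub_jbar_le` is attained. -/
theorem exists_le_frobInner_sub_jbar (a b c s t : ℝ) (hadd : a + c = s + t)
    (hmul : a * c - b ^ 2 = s * t) :
    ∃ x y z : ℝ, (|s| + |t|) ^ 2 / 2 ≤ x * a + 2 * y * b + z * c - jbar !![x, y; y, z] := by
  have hS : (|s| + |t|) ^ 2 = s ^ 2 + t ^ 2 + 2 * |s * t| := by
    rw [abs_mul, add_sq, sq_abs, sq_abs]; ring
  rw [hS]
  rcases abs_cases (s * t) with ⟨h, -⟩ | ⟨h, -⟩
  · refine ⟨a + c, 0, a + c, ?_⟩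
    have := jbar_le_fin_two (a + c) 0 (a + c) ((a + c) ^ 2 / 2) fun p q r hd => by
      nlinarith [sq_nonneg (a + c - (p + r))]
    rw [h]
    have e : s ^ 2 + t ^ 2 + 2 * (s * t) = (a + c) ^ 2 := by rw [hadd]; ring
    linarith
  · refine ⟨a - c, 2 * b, c - a, ?_⟩
    have := jbar_le_fin_two (a - c) (2 * b) (c - a) (((a - c) ^ 2 + 4 * b ^ 2) / 2)
      fun p q r hd => by
        nlinarith [sq_nonneg (a - c - (p - r)), sq_nonneg (b - q)]
    rw [h]
    have e : s ^ 2 + t ^ 2 + 2 * -(s * t) = (a - c) ^ 2 + 4 * b ^ 2 := by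
      linear_combination -(a + c + s + t) * hadd + 4 * hmul
    linarith

theorem add_and_mul_eq_of_charpoly_fin_two (τ : Matrix (Fin 2) (Fin 2) ℝ) (e : Fin 2 → ℝ)
    (h : τ.charpoly = ∏ i : Fin 2, (Polynomial.X - Polynomial.C (e i))) :
    τ.trace = e 0 + e 1 ∧ τ.det = e 0 * e 1 := by
  rw [Matrix.charpoly_fin_two, Fin.prod_univ_two] at h
  have h0 := congrArg (Polynomial.eval 0) h
  have h1 := congrArg (Polynomial.eval 1) h
  simp at h0 h1
  exact ⟨by linarith, h0⟩

theorem jbarStar_dim2 (τ : Matrix (Fin 2) (Fin 2) ℝ) (hτ : τ.IsSymm)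
    (e : Fin 2 → ℝ)
    (heig : τ.charpoly = ∏ i : Fin 2, (Polynomial.X - Polynomial.C (e i))) :
    jbarStar τ = (|e 0| + |e 1|) ^ 2 / 2 := by
  obtain ⟨hadd, hmul⟩ := add_and_mul_eq_of_charpoly_fin_two τ e heig
  obtain ⟨a, b, c, rfl⟩ := hτ.exists_eq_fin_two
  rw [Matrix.trace_fin_two_of] at hadd
  rw [Matrix.det_fin_two_of, ← pow_two] at hmul
  obtain ⟨x, y, z, hxyz⟩ := exists_le_frobInner_sub_jbar a b c (e 0) (e 1) hadd hmul
  refine IsGreatest.csSup_eq ⟨⟨!![x, y; y, z], isSymm_fin_two_of x y z, ?_⟩, ?_⟩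
  · rw [frobInner_fin_two_of]
    exact le_antisymm hxyz (frobInner_sub_jbar_le a b c (e 0) (e 1) x y z hadd hmul)
  · rintro v ⟨ξ, hξ, rfl⟩
    obtain ⟨x, y, z, rfl⟩ := hξ.exists_eq_fin_two
    rw [frobInner_fin_two_of]
    exact frobInner_sub_jbar_le a b c (e 0) (e 1) x y z hadd hmul
end

section
/- For every real symmetric 3×3 matrix τ with eigenvalues τ₁, τ₂, τ₃ ordered by increasing absolute value, one has j̄*(τ) = ½[(|τ₁| + |τ₂|)² + τ₃²] if |τ₁| + |τ₂| ≤ |τ₃|, and j̄*(τ) = ¼(|τ₁| + |τ₂| + |τ₃|)² if |τ₁| + |τ₂| > |τ₃|, where j̄*(τ) := sup{ ξ:τ − j̄(ξ) : ξ real symmetric 3×3 } and j̄(ξ) := sup{ ξ:σ − ½|σ|² : σ real symmetric 3×3 with det σ = 0 }. -/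
open Matrix Polynomial
open scoped BigOperators

/-- The matrix obtained by conjugating the diagonal matrix with entries `x` by `Q`. -/
noncomputable def conjDiagonal {n : ℕ} (Q : Matrix (Fin n) (Fin n) ℝ) (x : Fin n → ℝ) :
    Matrix (Fin n) (Fin n) ℝ :=
  Q * diagonal x * Qᵀ

lemma frobInner_self {n : ℕ} {σ : Matrix (Fin n) (Fin n) ℝ} (hσ : σ.IsSymm) :
    frobInner σ σ = frobSq σ := by
  simp only [frobInner, frobSq, Matrix.trace, Matrix.diag, Matrix.mul_apply]
  refine Finset.sum_congr rfl fun i _ => Finset.sum_congr rfl fun j _ => ?_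
  rw [hσ.apply i j, sq]

lemma frobSq_nonneg {n : ℕ} (σ : Matrix (Fin n) (Fin n) ℝ) : 0 ≤ frobSq σ :=
  Finset.sum_nonneg fun _ _ => Finset.sum_nonneg fun _ _ => sq_nonneg _

lemma frobInner_sub_half_frobSq {n : ℕ} {ξ σ : Matrix (Fin n) (Fin n) ℝ}
    (hξ : ξ.IsSymm) (hσ : σ.IsSymm) :
    frobInner ξ σ - frobSq σ / 2 = frobSq ξ / 2 - frobSq (ξ - σ) / 2 := by
  rw [← frobInner_self (hξ.sub hσ), ← frobInner_self hξ, ← frobInner_self hσ]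
  simp only [frobInner, sub_mul, mul_sub, Matrix.trace_sub, Matrix.trace_mul_comm σ ξ]
  ring

lemma frobInner_add_right {n : ℕ} (ξ σ τ : Matrix (Fin n) (Fin n) ℝ) :
    frobInner ξ (σ + τ) = frobInner ξ σ + frobInner ξ τ := by
  simp [frobInner, mul_add]

lemma frobInner_smul_right {n : ℕ} (c : ℝ) (ξ σ : Matrix (Fin n) (Fin n) ℝ) :
    frobInner ξ (c • σ) = c * frobInner ξ σ := by
  simp [frobInner]

lemma le_jbar {n : ℕ} {ξ σ : Matrix (Fin n) (Fin n) ℝ} (hξ : ξ.IsSymm) (hσ : σ.IsSymm)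
    (hdet : σ.det = 0) : frobInner ξ σ - frobSq σ / 2 ≤ jbar ξ := by
  refine le_csSup ⟨frobSq ξ / 2, ?_⟩ ⟨σ, hσ, hdet, rfl⟩
  rintro v ⟨ρ, hρ, -, rfl⟩
  rw [frobInner_sub_half_frobSq hξ hρ]
  linarith [frobSq_nonneg (ξ - ρ)]

lemma dotProduct_mulVec_self_le {n : ℕ} (M : Matrix (Fin n) (Fin n) ℝ) (v : Fin n → ℝ) :
    (M *ᵥ v) ⬝ᵥ (M *ᵥ v) ≤ frobSq M * (v ⬝ᵥ v) := by
  simp only [dotProduct, Matrix.mulVec, frobSq, Finset.sum_mul, ← sq]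
  refine Finset.sum_le_sum fun i _ => ?_
  rw [← Finset.sum_mul]
  exact Finset.sum_mul_sq_le_sq_mul_sq _ _ _

section conjDiagonal

variable {n : ℕ} {Q : Matrix (Fin n) (Fin n) ℝ}

lemma conjDiagonal_isSymm (Q : Matrix (Fin n) (Fin n) ℝ) (x : Fin n → ℝ) :
    (conjDiagonal Q x).IsSymm := by
  simp [conjDiagonal, Matrix.IsSymm, Matrix.transpose_mul, mul_assoc]

lemma conjDiagonal_add (Q : Matrix (Fin n) (Fin n) ℝ) (x y : Fin n → ℝ) :
    conjDiagonal Q (x + y) = conjDiagonal Q x + conjDiagonal Q y := by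
  rw [conjDiagonal, conjDiagonal, conjDiagonal, ← add_mul, ← mul_add, Matrix.diagonal_add]
  rfl

lemma conjDiagonal_smul (Q : Matrix (Fin n) (Fin n) ℝ) (c : ℝ) (x : Fin n → ℝ) :
    conjDiagonal Q (c • x) = c • conjDiagonal Q x := by
  simp [conjDiagonal, Matrix.diagonal_smul]

lemma conjDiagonal_det_eq_zero (Q : Matrix (Fin n) (Fin n) ℝ) {x : Fin n → ℝ} {i : Fin n}
    (hi : x i = 0) : (conjDiagonal Q x).det = 0 := by
  simp [conjDiagonal, Finset.prod_eq_zero (Finset.mem_univ i) hi]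

lemma frobInner_conjDiagonal (hQ : Qᵀ * Q = 1) (x y : Fin n → ℝ) :
    frobInner (conjDiagonal Q x) (conjDiagonal Q y) = ∑ i, x i * y i := by
  have h : conjDiagonal Q x * conjDiagonal Q y = Q * (diagonal x * diagonal y * Qᵀ) := by
    simp only [conjDiagonal, mul_assoc]
    rw [← mul_assoc Qᵀ Q, hQ, one_mul]
  rw [frobInner, h, Matrix.trace_mul_comm, mul_assoc, hQ, mul_one, Matrix.diagonal_mul_diagonal,
    Matrix.trace_diagonal]

lemma frobSq_conjDiagonal (hQ : Qᵀ * Q = 1) (x : Fin n → ℝ) :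
    frobSq (conjDiagonal Q x) = ∑ i, x i ^ 2 := by
  simp only [← frobInner_self (conjDiagonal_isSymm Q x), frobInner_conjDiagonal hQ, sq]

lemma dotProduct_mulVec_of_orthogonal (hQ : Qᵀ * Q = 1) (v : Fin n → ℝ) :
    (Q *ᵥ v) ⬝ᵥ (Q *ᵥ v) = v ⬝ᵥ v := by
  rw [Matrix.dotProduct_mulVec, Matrix.vecMul_mulVec, ← Matrix.dotProduct_mulVec, hQ,
    Matrix.one_mulVec]

lemma le_dotProduct_conjDiagonal_mulVec (hQ : Qᵀ * Q = 1) {x : Fin n → ℝ} {c : ℝ}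
    (hc : ∀ i, c ≤ x i ^ 2) (v : Fin n → ℝ) :
    c * (v ⬝ᵥ v) ≤ (conjDiagonal Q x *ᵥ v) ⬝ᵥ (conjDiagonal Q x *ᵥ v) := by
  have hQ' : Qᵀᵀ * Qᵀ = 1 := by rw [Matrix.transpose_transpose, mul_eq_one_comm.mp hQ]
  rw [conjDiagonal, ← Matrix.mulVec_mulVec, ← Matrix.mulVec_mulVec,
    dotProduct_mulVec_of_orthogonal hQ, ← dotProduct_mulVec_of_orthogonal hQ' v]
  simp only [dotProduct, Matrix.mulVec_diagonal, Finset.mul_sum]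
  refine Finset.sum_le_sum fun i _ => ?_
  nlinarith [mul_le_mul_of_nonneg_right (hc i) (mul_self_nonneg ((Qᵀ *ᵥ v) i))]

/-- The squared distance to the singular matrices is at least the smallest squared eigenvalue. -/
lemma jbar_conjDiagonal_le (hQ : Qᵀ * Q = 1) [NeZero n] {x : Fin n → ℝ} {c : ℝ}
    (hc : ∀ i, c ≤ x i ^ 2) :
    jbar (conjDiagonal Q x) ≤ (∑ i, x i ^ 2 - c) / 2 := by
  refine csSup_le ⟨_, 0, Matrix.isSymm_zero, Matrix.det_zero, rfl⟩ ?_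
  rintro v ⟨σ, hσ, hdet, rfl⟩
  obtain ⟨w, hw, hσw⟩ := Matrix.exists_mulVec_eq_zero_iff.mpr hdet
  have h1 := le_dotProduct_conjDiagonal_mulVec hQ hc w
  have h2 := dotProduct_mulVec_self_le (conjDiagonal Q x - σ) w
  rw [Matrix.sub_mulVec, hσw, sub_zero] at h2
  have hpos : 0 < w ⬝ᵥ w :=
    lt_of_le_of_ne (Finset.sum_nonneg fun i _ => mul_self_nonneg (w i))
      fun h => hw (dotProduct_self_eq_zero.mp h.symm)
  have h3 : c ≤ frobSq (conjDiagonal Q x - σ) := le_of_mul_le_mul_right (h1.trans h2) hpos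
  rw [frobInner_sub_half_frobSq (conjDiagonal_isSymm Q x) hσ, frobSq_conjDiagonal hQ]
  linarith

lemma frobInner_conjDiagonal_le (hQ : Qᵀ * Q = 1) {ξ : Matrix (Fin n) (Fin n) ℝ} (hξ : ξ.IsSymm)
    {x : Fin n → ℝ} {i : Fin n} (hi : x i = 0) :
    frobInner ξ (conjDiagonal Q x) ≤ jbar ξ + (∑ j, x j ^ 2) / 2 := by
  have := le_jbar hξ (conjDiagonal_isSymm Q x) (conjDiagonal_det_eq_zero Q hi)
  rw [frobSq_conjDiagonal hQ] at this
  linarith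

/-- The value of `jbarStar` is certified by a dual point and a uniform upper bound. -/
lemma jbarStar_conjDiagonal_eq (hQ : Qᵀ * Q = 1) [NeZero n] {e x : Fin n → ℝ} {c B : ℝ}
    (hub : ∀ ξ : Matrix (Fin n) (Fin n) ℝ, ξ.IsSymm →
      frobInner ξ (conjDiagonal Q e) ≤ jbar ξ + B)
    (hc : ∀ i, c ≤ x i ^ 2) (hB : B ≤ ∑ i, x i * e i - (∑ i, x i ^ 2 - c) / 2) :
    jbarStar (conjDiagonal Q e) = B := by
  have hbound : ∀ v ∈ {v : ℝ | ∃ ξ : Matrix (Fin n) (Fin n) ℝ,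
      ξ.IsSymm ∧ v = frobInner ξ (conjDiagonal Q e) - jbar ξ}, v ≤ B := by
    rintro v ⟨ξ, hξ, rfl⟩
    linarith [hub ξ hξ]
  refine le_antisymm (csSup_le ⟨_, 0, Matrix.isSymm_zero, rfl⟩ hbound) ?_
  refine le_csSup_of_le ⟨B, hbound⟩ ⟨conjDiagonal Q x, conjDiagonal_isSymm Q x, rfl⟩ ?_
  rw [frobInner_conjDiagonal hQ]
  linarith [jbar_conjDiagonal_le hQ hc]

end conjDiagonal

lemma exists_perm_of_map_univ_eq {ι α : Type*} [Fintype ι] [DecidableEq α] {f g : ι → α}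
    (h : Multiset.map f Finset.univ.val = Multiset.map g Finset.univ.val) :
    ∃ p : Equiv.Perm ι, g ∘ p = f := by
  have hcard : ∀ a, Nonempty ({i // f i = a} ≃ {i // g i = a}) := fun a => by
    refine ⟨Fintype.equivOfCardEq ?_⟩
    have := congrArg (Multiset.count a) h
    simp only [Multiset.count_map, eq_comm (a := a)] at this
    rw [Fintype.card_subtype, Fintype.card_subtype]
    exact this
  let E := fun a => (hcard a).some
  exact ⟨Equiv.ofFiberEquiv E, funext (Equiv.ofFiberEquiv_map E)⟩

/-- A real symmetric matrix is orthogonally diagonalizable with its eigenvalues in any order. -/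
lemma exists_orthogonal_conjDiagonal {n : ℕ} {τ : Matrix (Fin n) (Fin n) ℝ} (hτ : τ.IsSymm)
    {e : Fin n → ℝ} (heig : τ.charpoly = ∏ i, (X - C (e i))) :
    ∃ Q : Matrix (Fin n) (Fin n) ℝ, Qᵀ * Q = 1 ∧ τ = conjDiagonal Q e := by
  have hH : τ.IsHermitian := by
    rw [Matrix.IsHermitian, Matrix.conjTranspose_eq_transpose_of_trivial, hτ.eq]
  have hroots : Multiset.map e Finset.univ.val =
      Multiset.map hH.eigenvalues Finset.univ.val := by
    have h := hH.roots_charpoly_eq_eigenvalues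
    rw [heig, Polynomial.roots_prod _ _
      (Finset.prod_ne_zero_iff.mpr fun i _ => Polynomial.X_sub_C_ne_zero _)] at h
    simpa using h
  obtain ⟨p, hp⟩ := exists_perm_of_map_univ_eq hroots
  set U : Matrix (Fin n) (Fin n) ℝ := hH.eigenvectorUnitary.val
  have hUU : Uᵀ * U = 1 := by
    have := Unitary.coe_star_mul_self hH.eigenvectorUnitary
    rwa [Matrix.star_eq_conjTranspose, Matrix.conjTranspose_eq_transpose_of_trivial] at this
  have hspec : τ = U * diagonal hH.eigenvalues * Uᵀ := by
    have := hH.spectral_theorem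
    rw [Unitary.conjStarAlgAut_apply, Matrix.star_eq_conjTranspose,
      Matrix.conjTranspose_eq_transpose_of_trivial] at this
    exact this
  refine ⟨U.submatrix id p, ?_, ?_⟩
  · rw [Matrix.transpose_submatrix, ← Matrix.submatrix_mul _ _ _ _ _ Function.bijective_id, hUU,
      Matrix.submatrix_one_equiv]
  · rw [conjDiagonal, ← hp, ← Matrix.submatrix_diagonal_equiv, Matrix.transpose_submatrix,
      Matrix.submatrix_mul_equiv, Matrix.submatrix_mul_equiv, Matrix.submatrix_id_id]
    exact hspec

lemma abs_eq_sign_mul (a : ℝ) : ∃ s : ℝ, s ^ 2 = 1 ∧ s * a = |a| ∧ a = s * |a| := by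
  rcases le_total 0 a with h | h
  · exact ⟨1, by norm_num, by simp [abs_of_nonneg h], by simp [abs_of_nonneg h]⟩
  · exact ⟨-1, by norm_num, by simp [abs_of_nonpos h], by simp [abs_of_nonpos h]⟩

lemma jbarStar_conjDiagonal_of_add_le {Q : Matrix (Fin 3) (Fin 3) ℝ} (hQ : Qᵀ * Q = 1)
    {e : Fin 3 → ℝ} (h01 : |e 0| ≤ |e 1|) (h : |e 0| + |e 1| ≤ |e 2|) :
    jbarStar (conjDiagonal Q e) = ((|e 0| + |e 1|) ^ 2 + e 2 ^ 2) / 2 := by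
  obtain ⟨s, hs, hs0, hs0'⟩ := abs_eq_sign_mul (e 0)
  obtain ⟨t, ht, ht1, ht1'⟩ := abs_eq_sign_mul (e 1)
  set a := |e 0| + |e 1| with ha
  have ha0 : 0 ≤ a := by positivity
  refine jbarStar_conjDiagonal_eq hQ (x := ![s * a, t * a, e 2]) (c := a ^ 2) ?_ ?_ ?_
  · intro ξ hξ
    by_cases h0 : e 0 = 0
    · have := frobInner_conjDiagonal_le hQ hξ h0
      simpa [Fin.sum_univ_three, h0, ha] using this
    · have hp0 : 0 < |e 0| := abs_pos.mpr h0
      have hp1 : 0 < |e 1| := hp0.trans_le h01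
      have hpa : 0 < a := by positivity
      have hdec : conjDiagonal Q e =
          (|e 0| / a) • conjDiagonal Q ![s * a, 0, e 2] +
          (|e 1| / a) • conjDiagonal Q ![0, t * a, e 2] := by
        rw [← conjDiagonal_smul, ← conjDiagonal_smul, ← conjDiagonal_add]
        congr 1
        ext i
        fin_cases i
        · simp; field_simp; linarith
        · simp; field_simp; linarith
        · simp; field_simp; rw [ha]
      have h1 := frobInner_conjDiagonal_le hQ hξ (x := ![s * a, 0, e 2]) (i := 1) (by simp)
      have h2 := frobInner_conjDiagonal_le hQ hξ (x := ![0, t * a, e 2]) (i := 0) (by simp)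
      have hw : |e 0| / a + |e 1| / a = 1 := by rw [← add_div, ← ha, div_self hpa.ne']
      rw [hdec, frobInner_add_right, frobInner_smul_right, frobInner_smul_right]
      simp [Fin.sum_univ_three, mul_pow, hs, ht] at h1 h2
      calc _ ≤ |e 0| / a * (jbar ξ + (a ^ 2 + e 2 ^ 2) / 2) +
            |e 1| / a * (jbar ξ + (a ^ 2 + e 2 ^ 2) / 2) := by gcongr
        _ = _ := by rw [← add_mul, hw, one_mul]
  · have : a ^ 2 ≤ e 2 ^ 2 := by rw [← sq_abs (e 2)]; gcongr
    intro i
    fin_cases i <;> simp [mul_pow, hs, ht, this]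
  · simp [Fin.sum_univ_three, mul_pow, hs, ht]
    have h3 : s * a * e 0 + t * a * e 1 = a ^ 2 := by
      linear_combination a * hs0 + a * ht1 - a * ha
    linarith

lemma jbarStar_conjDiagonal_of_lt_add {Q : Matrix (Fin 3) (Fin 3) ℝ} (hQ : Qᵀ * Q = 1)
    {e : Fin 3 → ℝ} (h01 : |e 0| ≤ |e 1|) (h12 : |e 1| ≤ |e 2|) (h : |e 2| < |e 0| + |e 1|) :
    jbarStar (conjDiagonal Q e) = (|e 0| + |e 1| + |e 2|) ^ 2 / 4 := by
  obtain ⟨s, hs, hs0, hs0'⟩ := abs_eq_sign_mul (e 0)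
  obtain ⟨t, ht, ht1, ht1'⟩ := abs_eq_sign_mul (e 1)
  obtain ⟨u, hu, hu2, hu2'⟩ := abs_eq_sign_mul (e 2)
  set b := (|e 0| + |e 1| + |e 2|) / 2 with hb
  have hbpos : 0 < b := by linarith [abs_nonneg (e 2)]
  have hB : (|e 0| + |e 1| + |e 2|) ^ 2 / 4 = b ^ 2 := by rw [hb]; ring
  rw [hB]
  refine jbarStar_conjDiagonal_eq hQ (x := ![s * b, t * b, u * b]) (c := b ^ 2) ?_ ?_ ?_
  · intro ξ hξ
    have hdec : conjDiagonal Q e =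
        (1 - |e 0| / b) • conjDiagonal Q ![0, t * b, u * b] +
        (1 - |e 1| / b) • conjDiagonal Q ![s * b, 0, u * b] +
        (1 - |e 2| / b) • conjDiagonal Q ![s * b, t * b, 0] := by
      simp only [← conjDiagonal_smul, ← conjDiagonal_add]
      congr 1
      ext i
      fin_cases i
      · simp; field_simp; linear_combination hs0' + 2 * s * hb
      · simp; field_simp; linear_combination ht1' + 2 * t * hb
      · simp; field_simp; linear_combination hu2' + 2 * u * hb
    have h0 := frobInner_conjDiagonal_le hQ hξ (x := ![0, t * b, u * b]) (i := 0) (by simp)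
    have h1 := frobInner_conjDiagonal_le hQ hξ (x := ![s * b, 0, u * b]) (i := 1) (by simp)
    have h2 := frobInner_conjDiagonal_le hQ hξ (x := ![s * b, t * b, 0]) (i := 2) (by simp)
    have w0 : 0 ≤ 1 - |e 0| / b := by
      rw [sub_nonneg, div_le_one hbpos]; linarith
    have w1 : 0 ≤ 1 - |e 1| / b := by
      rw [sub_nonneg, div_le_one hbpos]; linarith [abs_nonneg (e 0)]
    have w2 : 0 ≤ 1 - |e 2| / b := by
      rw [sub_nonneg, div_le_one hbpos]; linarith
    have hw : 1 - |e 0| / b + (1 - |e 1| / b) + (1 - |e 2| / b) = 1 := by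
      field_simp; linarith
    rw [hdec]
    simp only [frobInner_add_right, frobInner_smul_right]
    simp [Fin.sum_univ_three, mul_pow, hs, ht, hu] at h0 h1 h2
    calc _ ≤ (1 - |e 0| / b) * (jbar ξ + b ^ 2) + (1 - |e 1| / b) * (jbar ξ + b ^ 2) +
          (1 - |e 2| / b) * (jbar ξ + b ^ 2) := by gcongr
      _ = _ := by rw [← add_mul, ← add_mul, hw, one_mul]
  · intro i
    fin_cases i <;> simp [mul_pow, hs, ht, hu]
  · simp [Fin.sum_univ_three, mul_pow, hs, ht, hu]
    have h3 : s * b * e 0 + t * b * e 1 + u * b * e 2 = 2 * b ^ 2 := by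
      linear_combination b * hs0 + b * ht1 + b * hu2 - 2 * b * hb
    linarith

theorem jbarStar_dim3 (τ : Matrix (Fin 3) (Fin 3) ℝ) (hτ : τ.IsSymm)
    (e : Fin 3 → ℝ)
    (heig : τ.charpoly = ∏ i : Fin 3, (Polynomial.X - Polynomial.C (e i)))
    (hord : ∀ i j : Fin 3, i ≤ j → |e i| ≤ |e j|) :
    (|e 0| + |e 1| ≤ |e 2| →
      jbarStar τ = ((|e 0| + |e 1|) ^ 2 + e 2 ^ 2) / 2) ∧
    (|e 2| < |e 0| + |e 1| →
      jbarStar τ = (|e 0| + |e 1| + |e 2|) ^ 2 / 4) := by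
  obtain ⟨Q, hQ, rfl⟩ := exists_orthogonal_conjDiagonal hτ heig
  have h01 := hord 0 1 (by decide)
  have h12 := hord 1 2 (by decide)
  exact ⟨jbarStar_conjDiagonal_of_add_le hQ h01, jbarStar_conjDiagonal_of_lt_add hQ h01 h12⟩
end
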